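/- arXiv:1401.3093 — 3 statements merged into one kernel-verified Lean document; each statement's English description precedes it below -/
import Mathlib

section
/- Let n ≥ 2 and D be integers with n ≤ D, set m = 1 + ⌊D/n⌋, and assume m ≤ n. Then there exists a code C ⊆ S_n with |C| ≤ n! · n · e^m · ln(m) / m^n such that every permutation π ∈ S_n satisfies d_K(π,C) ≤ D. (Equivalently, with δ = D/n, the minimum worst-case covering code size M̂_K(D) satisfies (1/n)·lg(M̂_K(D)/n!) ≤ −lg⌊1+δ⌋ + (1/n)·lg(n·e^{⌊1+δ⌋}·ln⌊1+δ⌋).) -/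
/-- The set of adjacent transpositions in `S_n`. -/
def adjacentTranspositions (n : ℕ) : Set (Equiv.Perm (Fin n)) :=
  {t | ∃ (i : ℕ) (h : i + 1 < n), t = Equiv.swap ⟨i, Nat.lt_of_succ_lt h⟩ ⟨i + 1, h⟩}

/-- Kendall τ-distance: the minimum number of adjacent transpositions
needed to transform `π` into `σ`. -/
noncomputable def kendallDist {n : ℕ} (π σ : Equiv.Perm (Fin n)) : ℕ :=
  sInf {k | ∃ l : List (Equiv.Perm (Fin n)), l.length = k ∧
    (∀ t ∈ l, t ∈ adjacentTranspositions n) ∧ σ = π * l.prod}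

/-- `kendallBall n r` is the number of permutations in `S_n` at Kendall
τ-distance at most `r` from the identity. -/
noncomputable def kendallBall (n r : ℕ) : ℕ :=
  (Finset.univ.filter (fun σ : Equiv.Perm (Fin n) => kendallDist σ 1 ≤ r)).card

/-- The minimal Kendall τ-distance from `π` to a codeword of `C`. -/
noncomputable def kendallDistToCode {n : ℕ} (π : Equiv.Perm (Fin n))
    (C : Finset (Equiv.Perm (Fin n))) : ℕ :=
  sInf (kendallDist π '' ↑C)

open Finset

/-- `σ` is a product of at most `k` adjacent transpositions. -/
def IsAdjacentWord {n : ℕ} (k : ℕ) (σ : Equiv.Perm (Fin n)) : Prop :=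
  ∃ l : List (Equiv.Perm (Fin n)), l.length ≤ k ∧
    (∀ t ∈ l, t ∈ adjacentTranspositions n) ∧ σ = l.prod

theorem IsAdjacentWord.one {n : ℕ} (k : ℕ) : IsAdjacentWord k (1 : Equiv.Perm (Fin n)) :=
  ⟨[], by simp⟩

theorem IsAdjacentWord.of_mem {n : ℕ} {t : Equiv.Perm (Fin n)}
    (ht : t ∈ adjacentTranspositions n) : IsAdjacentWord 1 t :=
  ⟨[t], by simpa using ht⟩

theorem IsAdjacentWord.mono {n j k : ℕ} {σ : Equiv.Perm (Fin n)} (h : IsAdjacentWord j σ)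
    (hjk : j ≤ k) : IsAdjacentWord k σ := by
  obtain ⟨l, hl, h⟩ := h
  exact ⟨l, hl.trans hjk, h⟩

theorem IsAdjacentWord.mul {n j k : ℕ} {σ τ : Equiv.Perm (Fin n)} (hσ : IsAdjacentWord j σ)
    (hτ : IsAdjacentWord k τ) : IsAdjacentWord (j + k) (σ * τ) := by
  obtain ⟨l, hl, h, rfl⟩ := hσ
  obtain ⟨l', hl', h', rfl⟩ := hτ
  refine ⟨l ++ l', by simp; omega, ?_, by simp⟩
  intro t ht
  rcases List.mem_append.1 ht with ht | ht
  exacts [h t ht, h' t ht]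

theorem kendallDist_le_of_isAdjacentWord {n k : ℕ} {π σ : Equiv.Perm (Fin n)}
    (h : IsAdjacentWord k (π⁻¹ * σ)) : kendallDist π σ ≤ k := by
  obtain ⟨l, hl, h, hp⟩ := h
  refine le_trans (Nat.sInf_le ?_) hl
  exact ⟨l, rfl, h, by rw [← hp]; group⟩

/-- The embedding of `S_n` into `S_{n+1}` as the stabilizer of `0`. -/
def permSucc (n : ℕ) : Equiv.Perm (Fin n) →* Equiv.Perm (Fin (n + 1)) where
  toFun e := Equiv.Perm.decomposeFin.symm (0, e)
  map_one' := by simp; rfl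
  map_mul' e f := by
    ext x
    refine Fin.cases ?_ (fun x => ?_) x <;> simp

theorem permSucc_apply_zero {n : ℕ} (e : Equiv.Perm (Fin n)) : permSucc n e 0 = 0 := by
  simp [permSucc]

theorem permSucc_apply_succ {n : ℕ} (e : Equiv.Perm (Fin n)) (x : Fin n) :
    permSucc n e x.succ = (e x).succ := by
  simp [permSucc]

theorem permSucc_injective (n : ℕ) : Function.Injective (permSucc n) := by
  intro e f h
  ext x
  have := congrArg (fun g : Equiv.Perm (Fin (n + 1)) => g x.succ) h
  simpa [permSucc_apply_succ] using congrArg Fin.val this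

theorem permSucc_mem_adjacentTranspositions {n : ℕ} {t : Equiv.Perm (Fin n)}
    (ht : t ∈ adjacentTranspositions n) : permSucc n t ∈ adjacentTranspositions (n + 1) := by
  obtain ⟨i, hi, rfl⟩ := ht
  refine ⟨i + 1, by omega, ?_⟩
  ext x
  refine Fin.cases ?_ (fun x => ?_) x
  · rw [permSucc_apply_zero, Equiv.swap_apply_of_ne_of_ne] <;> simp [Fin.ext_iff]
  · rw [permSucc_apply_succ]
    simp only [Equiv.swap_apply_def, Fin.ext_iff, Fin.val_succ, apply_ite Fin.val,
      add_left_inj]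
    split_ifs <;> rfl

theorem IsAdjacentWord.permSucc {n k : ℕ} {σ : Equiv.Perm (Fin n)} (h : IsAdjacentWord k σ) :
    IsAdjacentWord k (permSucc n σ) := by
  obtain ⟨l, hl, h, rfl⟩ := h
  refine ⟨l.map (_root_.permSucc n), by simpa using hl, ?_, map_list_prod _ _⟩
  intro t ht
  obtain ⟨s, hs, rfl⟩ := List.mem_map.1 ht
  exact permSucc_mem_adjacentTranspositions (h s hs)

theorem exists_isAdjacentWord_apply_zero {n : ℕ} (j : ℕ) (hj : j < n + 1) :
    ∃ c : Equiv.Perm (Fin (n + 1)), IsAdjacentWord j c ∧ c 0 = ⟨j, hj⟩ := by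
  induction j with
  | zero => exact ⟨1, .one 0, rfl⟩
  | succ j ih =>
    obtain ⟨c, hc, h0⟩ := ih (by omega)
    refine ⟨Equiv.swap ⟨j, by omega⟩ ⟨j + 1, hj⟩ * c, ?_, ?_⟩
    · exact ((IsAdjacentWord.of_mem ⟨j, hj, rfl⟩).mul hc).mono (by omega)
    · rw [Equiv.Perm.mul_apply, h0, Equiv.swap_apply_left]

/-- Permutations whose inversion table is bounded by `m - 1` entrywise are products of at most
`n * (m - 1)` adjacent transpositions; there are `∏ i < n, min m (i + 1)` of them. -/
theorem exists_finset_isAdjacentWord (m n : ℕ) :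
    ∃ S : Finset (Equiv.Perm (Fin n)), #S = ∏ i ∈ range n, min m (i + 1) ∧
      ∀ σ ∈ S, IsAdjacentWord (n * (m - 1)) σ := by
  induction n with
  | zero => exact ⟨{1}, by simp, fun σ hσ => by rw [mem_singleton.1 hσ]; exact .one _⟩
  | succ n ih =>
    obtain ⟨S, hS, hw⟩ := ih
    choose c hc hc0 using fun j : Fin (n + 1) => exists_isAdjacentWord_apply_zero j.1 j.2
    let J : Finset (Fin (n + 1)) := univ.filter fun j => j.1 < m
    have hJ : #J = min m (n + 1) := by
      rw [Fin.card_filter_val_lt, min_comm]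
    refine ⟨(J ×ˢ S).image fun p => c p.1 * permSucc n p.2, ?_, ?_⟩
    · rw [card_image_of_injective, card_product, hJ, hS, prod_range_succ, mul_comm]
      rintro ⟨j, σ⟩ ⟨j', σ'⟩ h
      have h0 : j = j' := by
        have := congrArg (fun g : Equiv.Perm (Fin (n + 1)) => g 0) h
        simpa [permSucc_apply_zero, hc0] using this
      subst h0
      exact Prod.ext rfl (permSucc_injective n (mul_left_cancel h))
    · intro τ hτ
      obtain ⟨⟨j, σ⟩, hp, rfl⟩ := mem_image.1 hτ
      obtain ⟨hj, hσ⟩ := mem_product.1 hp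
      have hj : j.1 < m := (mem_filter.1 hj).2
      exact ((hc j).mul (hw σ hσ).permSucc).mono (by simp only [add_mul]; omega)

theorem prod_range_min_succ (m k : ℕ) :
    ∏ i ∈ range (m + k), min m (i + 1) = m.factorial * m ^ k := by
  induction k with
  | zero =>
    rw [pow_zero, mul_one, add_zero, ← prod_range_add_one_eq_factorial]
    exact prod_congr rfl fun i hi => min_eq_right (mem_range.1 hi)
  | succ k ih =>
    rw [← add_assoc, prod_range_succ, ih, min_eq_left (by omega), pow_succ, mul_assoc]

section Covering

variable {G : Type*} [Group G] [Fintype G] [DecidableEq G]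

theorem exists_card_mul_card_div_le (W U : Finset G) :
    ∃ σ : G, (#U * #W / Fintype.card G : ℝ) ≤ #(U.filter fun π => π⁻¹ * σ ∈ W) := by
  have hsum : ∑ σ : G, #(U.filter fun π => π⁻¹ * σ ∈ W) = #U * #W := by
    rw [← smul_eq_mul, ← sum_const]
    simp only [card_filter]
    rw [sum_comm]
    refine sum_congr rfl fun π _ => ?_
    rw [← card_filter]
    exact card_bij (fun σ _ => π⁻¹ * σ) (by simp) (by simp)
      (fun w hw => ⟨π * w, by simpa using hw, by simp⟩)
  obtain ⟨σ, -, h⟩ := exists_le_of_sum_le (s := (univ : Finset G)) univ_nonempty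
    (f := fun _ => (#U * #W / Fintype.card G : ℝ))
    (g := fun σ => (#(U.filter fun π => π⁻¹ * σ ∈ W) : ℝ)) (by
      have hN : (Fintype.card G : ℝ) ≠ 0 := by simp
      rw [sum_const, ← Nat.cast_sum, hsum, nsmul_eq_mul, card_univ, Nat.cast_mul]
      field_simp
      rfl)
  exact ⟨σ, h⟩

/-- After `k` greedy choices, the proportion of uncovered elements is at most
`(1 - #W / #G) ^ k`. -/
theorem exists_card_uncovered_le (W : Finset G) (k : ℕ) :
    ∃ C : Finset G, #C ≤ k ∧
      (#(univ.filter fun π => ∀ σ ∈ C, π⁻¹ * σ ∉ W) : ℝ) ≤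
        Fintype.card G * (1 - #W / Fintype.card G : ℝ) ^ k := by
  have hN : (0 : ℝ) < Fintype.card G := by exact_mod_cast Fintype.card_pos
  have hW : (#W : ℝ) ≤ Fintype.card G := by exact_mod_cast card_le_univ W
  induction k with
  | zero => exact ⟨∅, by simp, by simp⟩
  | succ k ih =>
    obtain ⟨C, hC, hU⟩ := ih
    set U := univ.filter fun π => ∀ σ ∈ C, π⁻¹ * σ ∉ W with hUdef
    obtain ⟨τ, hτ⟩ := exists_card_mul_card_div_le W U
    refine ⟨insert τ C, (card_insert_le _ _).trans (by omega), ?_⟩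
    have heq : (univ.filter fun π => ∀ σ ∈ insert τ C, π⁻¹ * σ ∉ W) =
        U.filter fun π => ¬ π⁻¹ * τ ∈ W := by
      ext π
      simp [hUdef, and_comm]
    have hadd := card_filter_add_card_filter_not (s := U) (fun π => π⁻¹ * τ ∈ W)
    rw [heq]
    have hadd' : (#(U.filter fun π => π⁻¹ * τ ∈ W) : ℝ) +
        #(U.filter fun π => ¬ π⁻¹ * τ ∈ W) = #U := by exact_mod_cast hadd
    have hq : 0 ≤ 1 - (#W : ℝ) / Fintype.card G := by
      rw [sub_nonneg, div_le_one hN]; exact hW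
    calc (#(U.filter fun π => ¬ π⁻¹ * τ ∈ W) : ℝ)
        ≤ #U * (1 - #W / Fintype.card G) := by
          rw [mul_sub, mul_one, mul_div_assoc']
          linarith
      _ ≤ _ := by
          rw [pow_succ, ← mul_assoc]
          exact mul_le_mul_of_nonneg_right hU hq

/-- A finite group is covered by few translates of a nonempty subset `W`. -/
theorem exists_covering_card_le (W : Finset G) (hW : W.Nonempty) :
    ∃ C : Finset G, (#C : ℝ) ≤ Fintype.card G / #W * (Real.log #W + 2) ∧
      ∀ π : G, ∃ σ ∈ C, π⁻¹ * σ ∈ W := by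
  have hN : (0 : ℝ) < Fintype.card G := by exact_mod_cast Fintype.card_pos
  have hWN : (#W : ℝ) ≤ Fintype.card G := by exact_mod_cast card_le_univ W
  have hb : (0 : ℝ) < #W := by exact_mod_cast hW.card_pos
  have hb1 : (1 : ℝ) ≤ #W := by exact_mod_cast hW.card_pos
  obtain ⟨w, hw⟩ := hW
  set x : ℝ := Fintype.card G / #W * Real.log #W with hx
  have hx0 : 0 ≤ x := mul_nonneg (by positivity) (Real.log_nonneg hb1)
  obtain ⟨C, hC, hU⟩ := exists_card_uncovered_le W ⌈x⌉₊
  set U := univ.filter fun π => ∀ σ ∈ C, π⁻¹ * σ ∉ W with hUdef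
  refine ⟨C ∪ U.image (· * w), ?_, fun π => ?_⟩
  · have hUle : (#U : ℝ) ≤ Fintype.card G / #W := by
      refine hU.trans ?_
      rw [div_eq_mul_inv (Fintype.card G : ℝ)]
      refine mul_le_mul_of_nonneg_left ?_ hN.le
      have hq : 0 ≤ 1 - (#W : ℝ) / Fintype.card G := by
        rw [sub_nonneg, div_le_one hN]; exact hWN
      calc (1 - (#W : ℝ) / Fintype.card G) ^ ⌈x⌉₊
          ≤ Real.exp (-(#W / Fintype.card G)) ^ ⌈x⌉₊ :=
            pow_le_pow_left₀ hq (Real.one_sub_le_exp_neg _) _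
        _ = Real.exp (-(⌈x⌉₊ * (#W / Fintype.card G))) := by
            rw [← Real.exp_nat_mul, mul_neg]
        _ ≤ Real.exp (-Real.log #W) := by
            refine Real.exp_le_exp.2 (neg_le_neg ?_)
            calc Real.log #W = x * (#W / Fintype.card G) := by rw [hx]; field_simp
              _ ≤ _ := mul_le_mul_of_nonneg_right (Nat.le_ceil x) (by positivity)
        _ = (#W : ℝ)⁻¹ := by rw [Real.exp_neg, Real.exp_log hb]
    have hcard : #(C ∪ U.image (· * w)) ≤ ⌈x⌉₊ + #U :=
      (card_union_le _ _).trans (add_le_add hC card_image_le)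
    have hcard' : (#(C ∪ U.image (· * w)) : ℝ) ≤ ⌈x⌉₊ + #U := by exact_mod_cast hcard
    have hceil := Nat.ceil_lt_add_one hx0
    have hone : 1 ≤ (Fintype.card G : ℝ) / #W := (one_le_div hb).2 hWN
    rw [mul_add]
    linarith
  · by_cases h : ∃ σ ∈ C, π⁻¹ * σ ∈ W
    · obtain ⟨σ, hσ, h⟩ := h
      exact ⟨σ, mem_union_left _ hσ, h⟩
    · push Not at h
      exact ⟨π * w, mem_union_right _ (mem_image_of_mem _ (by simpa [hUdef] using h)),
        by simpa using hw⟩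

end Covering

theorem two_mul_factorial_le_pow_self {m : ℕ} (hm : 2 ≤ m) : 2 * m.factorial ≤ m ^ m := by
  induction m, hm using Nat.le_induction with
  | base => decide
  | succ m _ ih =>
    calc 2 * (m + 1).factorial = (m + 1) * (2 * m.factorial) := by
          rw [Nat.factorial_succ]; ring
      _ ≤ (m + 1) * (m + 1) ^ m :=
          Nat.mul_le_mul_left _ (ih.trans (Nat.pow_le_pow_left (by omega) _))
      _ = (m + 1) ^ (m + 1) := by ring

theorem two_mul_pow_self_le_factorial_mul_exp {m : ℕ} (hm : 1 ≤ m) :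
    2 * (m : ℝ) ^ m ≤ m.factorial * Real.exp m := by
  obtain ⟨p, rfl⟩ : ∃ p, m = p + 1 := ⟨m - 1, by omega⟩
  have h := Real.sum_le_exp_of_nonneg (x := ((p + 1 : ℕ) : ℝ)) (by positivity) (p + 2)
  rw [sum_range_succ, sum_range_succ] at h
  set x : ℝ := ((p + 1 : ℕ) : ℝ) with hx
  have h0 : 0 ≤ ∑ i ∈ range p, x ^ i / (i.factorial : ℝ) :=
    sum_nonneg fun i _ => by positivity
  have hp : (0 : ℝ) < p.factorial := by positivity
  have hf : ((p + 1).factorial : ℝ) = x * p.factorial := by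
    rw [Nat.factorial_succ, Nat.cast_mul]
  have hx0 : 0 < x := by positivity
  have hterm : x ^ (p + 1) / ((p + 1).factorial : ℝ) = x ^ p / p.factorial := by
    rw [hf, pow_succ]; field_simp
  have hexp : 2 * (x ^ p / p.factorial) ≤ Real.exp x := by linarith
  calc 2 * x ^ (p + 1) = (x * p.factorial) * (2 * (x ^ p / p.factorial)) := by
        rw [pow_succ]; field_simp
    _ ≤ _ := by rw [hf]; exact mul_le_mul_of_nonneg_left hexp (by positivity)

/-- With `b = m! * m ^ k`, the covering bound `(log b + 2) / b` is at most
`(m + k) * e ^ m * log m / m ^ (m + k)`. -/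
theorem log_factorial_mul_pow_add_two_div_le {m : ℕ} (hm : 2 ≤ m) (k : ℕ) :
    (Real.log (m.factorial * m ^ k : ℝ) + 2) / (m.factorial * m ^ k : ℝ) ≤
      (m + k : ℝ) * Real.exp m * Real.log m / (m : ℝ) ^ (m + k) := by
  have hm0 : (0 : ℝ) < m := by positivity
  have hm2 : (2 : ℝ) ≤ m := by exact_mod_cast hm
  have hb : (0 : ℝ) < m.factorial * (m : ℝ) ^ k := by positivity
  have hlogb : Real.log (m.factorial * m ^ k : ℝ) + Real.log 2 ≤ (m + k) * Real.log m := by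
    rw [← Real.log_mul hb.ne' two_ne_zero, ← Nat.cast_add, ← Real.log_pow]
    refine Real.log_le_log (by positivity) ?_
    have h : (2 * m.factorial : ℝ) ≤ (m : ℝ) ^ m := by
      exact_mod_cast two_mul_factorial_le_pow_self hm
    calc (m.factorial * m ^ k * 2 : ℝ) = 2 * m.factorial * (m : ℝ) ^ k := by ring
      _ ≤ m ^ m * m ^ k := mul_le_mul_of_nonneg_right h (by positivity)
      _ = _ := (pow_add _ _ _).symm
  have hlog2 := Real.log_two_gt_d9
  have hlogm : Real.log 2 ≤ Real.log m := Real.log_le_log two_pos hm2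
  have hbig : 2 * Real.log 2 ≤ (m + k) * Real.log m := by
    refine mul_le_mul ?_ hlogm (by linarith) (by positivity)
    have : (0 : ℝ) ≤ k := by positivity
    linarith
  have hle : Real.log (m.factorial * m ^ k : ℝ) + 2 ≤ 2 * ((m + k) * Real.log m) := by
    linarith
  have hexp : 2 * (m : ℝ) ^ (m + k) ≤ m.factorial * m ^ k * Real.exp m := by
    have := mul_le_mul_of_nonneg_right
      (two_mul_pow_self_le_factorial_mul_exp (show 1 ≤ m by omega))
      (show (0 : ℝ) ≤ (m : ℝ) ^ k by positivity)
    rw [pow_add]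
    linarith
  rw [div_le_div_iff₀ hb (by positivity)]
  calc (Real.log (m.factorial * m ^ k : ℝ) + 2) * (m : ℝ) ^ (m + k)
      ≤ 2 * ((m + k) * Real.log m) * (m : ℝ) ^ (m + k) :=
        mul_le_mul_of_nonneg_right hle (by positivity)
    _ = ((m + k) * Real.log m) * (2 * (m : ℝ) ^ (m + k)) := by ring
    _ ≤ ((m + k) * Real.log m) * (m.factorial * m ^ k * Real.exp m) :=
        mul_le_mul_of_nonneg_left hexp (by linarith)
    _ = _ := by ring

/-- For `n ≤ D` and `m = 1 + ⌊D/n⌋ ≤ n`, there is a covering code for worst-case Kendall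
τ-distortion `D` of size at most `n!·n·e^m·ln(m) / m^n`. -/
theorem stmt_12 (n D : ℕ) (hn : 2 ≤ n) (hD : n ≤ D) (m : ℕ) (hm : m = 1 + D / n)
    (hmn : m ≤ n) :
    ∃ C : Finset (Equiv.Perm (Fin n)),
      (C.card : ℝ) ≤ (n.factorial : ℝ) * (n : ℝ) * Real.exp (m : ℝ) * Real.log (m : ℝ) /
        (m : ℝ) ^ n ∧
      ∀ π : Equiv.Perm (Fin n), ∃ σ ∈ C, kendallDist π σ ≤ D := by
  have hm2 : 2 ≤ m := by
    have := Nat.div_pos hD (by omega)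
    omega
  obtain ⟨S, hS, hw⟩ := exists_finset_isAdjacentWord m n
  obtain ⟨k, hk⟩ := Nat.exists_eq_add_of_le hmn
  have hcard : #S = m.factorial * m ^ k := by rw [hS, hk, prod_range_min_succ]
  have hne : S.Nonempty := by
    rw [← card_pos, hcard]
    positivity
  obtain ⟨C, hC, hcov⟩ := exists_covering_card_le S hne
  refine ⟨C, hC.trans ?_, fun π => ?_⟩
  · have h := mul_le_mul_of_nonneg_left (log_factorial_mul_pow_add_two_div_le hm2 k)
      (show (0 : ℝ) ≤ n.factorial by positivity)
    have hn' : (n : ℝ) = m + k := by rw [hk, Nat.cast_add]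
    rw [Fintype.card_perm, Fintype.card_fin, hcard, Nat.cast_mul, Nat.cast_pow]
    calc _ = _ := by ring
      _ ≤ _ := h
      _ = _ := by rw [← hn', ← hk]; ring
  · obtain ⟨σ, hσ, h⟩ := hcov π
    refine ⟨σ, hσ, kendallDist_le_of_isAdjacentWord ((hw _ h).mono ?_)⟩
    rw [hm, Nat.add_sub_cancel_left]
    exact Nat.mul_div_le D n
end

section
/- Let n and D be positive integers. Every code C ⊆ S_n such that d_K(π,C) ≤ D for all π ∈ S_n satisfies |C| ≥ n! · n^n / (e^n · (n+D)^n). (Equivalently, with δ = D/n, (1/n)·lg(|C|/n!) ≥ −lg(e·(1+δ)).) -/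
open Finset

/-- The inversions of a permutation: pairs of positions `i < j` with `σ j < σ i`. -/
def permInversions {n : ℕ} (σ : Equiv.Perm (Fin n)) : Finset (Fin n × Fin n) :=
  univ.filter fun p => p.1 < p.2 ∧ σ p.2 < σ p.1

theorem mem_permInversions {n : ℕ} {σ : Equiv.Perm (Fin n)} {p : Fin n × Fin n} :
    p ∈ permInversions σ ↔ p.1 < p.2 ∧ σ p.2 < σ p.1 := by
  simp [permInversions]

/-- The Lehmer code of a permutation: the number of inversions starting at each position. -/
def lehmerCode {n : ℕ} (σ : Equiv.Perm (Fin n)) (i : Fin n) : ℕ :=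
  (univ.filter fun j => i < j ∧ σ j < σ i).card

theorem sum_lehmerCode {n : ℕ} (σ : Equiv.Perm (Fin n)) :
    ∑ i, lehmerCode σ i = (permInversions σ).card := by
  simp only [lehmerCode, permInversions, card_filter, Fintype.sum_prod_type]

theorem lehmerCode_lt_of_agree {n : ℕ} {σ τ : Equiv.Perm (Fin n)} {i : Fin n}
    (hagree : ∀ j < i, σ j = τ j) (hlt : σ i < τ i) : lehmerCode σ i < lehmerCode τ i := by
  have card_values (ρ : Equiv.Perm (Fin n)) :
      lehmerCode ρ i = (univ.filter fun v => i < ρ.symm v ∧ v < ρ i).card := by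
    refine card_bij (fun j _ => ρ j) ?_ (fun _ _ _ _ h => ρ.injective h) ?_
    · intro j hj
      simpa using hj
    · intro v hv
      exact ⟨ρ.symm v, by simpa using hv, by simp⟩
  have symm_le {v : Fin n} (hv : i ≤ σ.symm v) : i ≤ τ.symm v := by
    by_contra! h
    have heq : σ (τ.symm v) = v := by rw [hagree _ h, Equiv.apply_symm_apply]
    rw [← heq, Equiv.symm_apply_apply] at hv
    exact absurd h (not_lt.mpr hv)
  have lt_symm {v : Fin n} (hv : i ≤ σ.symm v) (hvτ : v < τ i) : i < τ.symm v := by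
    refine lt_of_le_of_ne (symm_le hv) fun h => ?_
    rw [h, Equiv.apply_symm_apply] at hvτ
    exact lt_irrefl _ hvτ
  rw [card_values, card_values]
  refine card_lt_card ((ssubset_iff_of_subset fun v hv => ?_).mpr ⟨σ i, ?_, by simp⟩)
  · obtain ⟨h₁, h₂⟩ := (mem_filter.mp hv).2
    exact mem_filter.mpr ⟨mem_univ _, lt_symm h₁.le (h₂.trans hlt), h₂.trans hlt⟩
  · exact mem_filter.mpr ⟨mem_univ _, lt_symm (by simp) hlt, hlt⟩

theorem lehmerCode_injective {n : ℕ} :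
    Function.Injective (lehmerCode : Equiv.Perm (Fin n) → Fin n → ℕ) := by
  intro σ τ h
  ext1 i
  induction i using WellFoundedLT.induction with
  | ind i ih =>
    rcases lt_trichotomy (σ i) (τ i) with hlt | heq | hlt
    · exact absurd (congrFun h i) (lehmerCode_lt_of_agree ih hlt).ne
    · exact heq
    · exact absurd (congrFun h i) (lehmerCode_lt_of_agree (fun j hj => (ih j hj).symm) hlt).ne'

theorem card_permInversions_adjacent_mul_le {n : ℕ} {t : Equiv.Perm (Fin n)}
    (ht : t ∈ adjacentTranspositions n) (σ : Equiv.Perm (Fin n)) :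
    (permInversions (t * σ)).card ≤ (permInversions σ).card + 1 := by
  obtain ⟨i, hi, rfl⟩ := ht
  refine le_trans (card_le_card ?_) (card_insert_le
    (σ.symm ⟨i, Nat.lt_of_succ_lt hi⟩, σ.symm ⟨i + 1, hi⟩) _)
  rintro ⟨a, b⟩ hab
  simp only [mem_permInversions, mem_insert, Prod.mk.injEq,
    Equiv.Perm.mul_apply, Equiv.eq_symm_apply] at hab ⊢
  obtain ⟨hlt, hswap⟩ := hab
  have hne : σ a ≠ σ b := σ.injective.ne hlt.ne
  rw [Equiv.swap_apply_def, Equiv.swap_apply_def] at hswap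
  simp only [Fin.ext_iff, Fin.lt_def, ne_eq] at *
  split_ifs at hswap <;> (try dsimp only at hswap) <;> omega

theorem card_permInversions_prod_le {n : ℕ} (l : List (Equiv.Perm (Fin n)))
    (hl : ∀ t ∈ l, t ∈ adjacentTranspositions n) :
    (permInversions l.prod).card ≤ l.length := by
  induction l with
  | nil =>
    rw [List.prod_nil, List.length_nil, nonpos_iff_eq_zero, card_eq_zero]
    exact filter_eq_empty_iff.mpr fun p _ h => lt_asymm h.1 h.2
  | cons t l ih =>
    rw [List.prod_cons, List.length_cons]
    exact (card_permInversions_adjacent_mul_le (hl t (by simp)) _).trans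
      (Nat.succ_le_succ (ih fun s hs => hl s (by simp [hs])))

theorem closure_adjacentTranspositions (n : ℕ) :
    Submonoid.closure (adjacentTranspositions n) = ⊤ := by
  cases n with
  | zero => exact Subsingleton.elim _ _
  | succ n =>
    rw [← Equiv.Perm.mclosure_swap_castSucc_succ n]
    congr 1
    ext t
    constructor
    · rintro ⟨i, hi, rfl⟩
      exact ⟨⟨i, Nat.lt_of_succ_lt_succ hi⟩, rfl⟩
    · rintro ⟨i, rfl⟩
      exact ⟨i, Nat.succ_lt_succ i.isLt, rfl⟩

theorem card_permInversions_le_kendallDist {n : ℕ} (π σ : Equiv.Perm (Fin n)) :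
    (permInversions (π⁻¹ * σ)).card ≤ kendallDist π σ := by
  have hne : {k | ∃ l : List (Equiv.Perm (Fin n)), l.length = k ∧
      (∀ t ∈ l, t ∈ adjacentTranspositions n) ∧ σ = π * l.prod}.Nonempty := by
    obtain ⟨l, hl, hprod⟩ := Submonoid.exists_list_of_mem_closure
      (closure_adjacentTranspositions n ▸ Submonoid.mem_top (π⁻¹ * σ))
    exact ⟨l.length, l, rfl, hl, by rw [hprod, mul_inv_cancel_left]⟩
  obtain ⟨l, hlen, hl, hσ⟩ := Nat.sInf_mem hne
  rw [kendallDist, ← hlen, hσ, inv_mul_cancel_left]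
  exact card_permInversions_prod_le l hl

theorem card_perm_inversions_le (n D : ℕ) :
    (univ.filter fun σ : Equiv.Perm (Fin n) => (permInversions σ).card ≤ D).card ≤
      (n + D).choose n := by
  have hcard : ((univ : Finset (Option (Fin n))).finsuppAntidiag D).card = (n + D).choose n := by
    rw [card_finsuppAntidiag_nat_eq_choose, card_univ, Fintype.card_option, Fintype.card_fin,
      Nat.choose_symm_of_eq_add (a := D) (b := n) (by omega)]
    congr 1
    omega
  rw [← hcard]
  refine card_le_card_of_injOn (fun σ => Finsupp.equivFunOnFinite.symm fun o : Option (Fin n) =>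
    o.elim (D - (permInversions σ).card) (lehmerCode σ)) ?_ ?_
  · intro σ hσ
    have hσ' : (permInversions σ).card ≤ D := by simpa using hσ
    simp [mem_finsuppAntidiag, Fintype.sum_option, sum_lehmerCode, hσ']
  · intro σ _ τ _ h
    refine lehmerCode_injective (funext fun i => ?_)
    exact congrFun (Finsupp.equivFunOnFinite.symm.injective h) (some i)

theorem card_kendallDist_le (n D : ℕ) (σ : Equiv.Perm (Fin n)) :
    (univ.filter fun π => kendallDist π σ ≤ D).card ≤ (n + D).choose n := by
  refine le_trans (card_le_card_of_injOn (fun π => π⁻¹ * σ) ?_ ?_) (card_perm_inversions_le n D)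
  · intro π hπ
    have hπ' : kendallDist π σ ≤ D := by simpa using hπ
    simpa using (card_permInversions_le_kendallDist π σ).trans hπ'
  · intro π _ ρ _ h
    exact inv_injective (mul_right_cancel h)

theorem factorial_le_card_mul_choose_of_covering {n D : ℕ} {C : Finset (Equiv.Perm (Fin n))}
    (hcov : ∀ π : Equiv.Perm (Fin n), ∃ σ ∈ C, kendallDist π σ ≤ D) :
    n.factorial ≤ C.card * (n + D).choose n := by
  have hunion : (C.biUnion fun σ => univ.filter fun π => kendallDist π σ ≤ D) = univ := by
    ext π
    simpa using hcov π
  calc n.factorial = (univ : Finset (Equiv.Perm (Fin n))).card := by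
        rw [card_univ, Fintype.card_perm, Fintype.card_fin]
    _ ≤ C.card * (n + D).choose n := by
        rw [← hunion]
        exact card_biUnion_le_card_mul _ _ _ fun σ _ => card_kendallDist_le n D σ

theorem choose_mul_pow_le_exp_mul_pow (n D : ℕ) :
    ((n + D).choose n : ℝ) * (n : ℝ) ^ n ≤ Real.exp n * ((n : ℝ) + D) ^ n := by
  have hchoose : ((n + D).choose n : ℝ) ≤ ((n : ℝ) + D) ^ n / n.factorial := by
    exact_mod_cast Nat.choose_le_pow_div (α := ℝ) n (n + D)
  calc ((n + D).choose n : ℝ) * (n : ℝ) ^ n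
      ≤ ((n : ℝ) + D) ^ n / n.factorial * (n : ℝ) ^ n := by gcongr
    _ = (n : ℝ) ^ n / n.factorial * ((n : ℝ) + D) ^ n := by ring
    _ ≤ Real.exp n * ((n : ℝ) + D) ^ n := by
        gcongr
        exact Real.pow_div_factorial_le_exp _ (Nat.cast_nonneg n) n

/-- Every code with worst-case Kendall τ-distortion at most `D` has size at least
`n!·n^n / (e^n·(n+D)^n)`. -/
theorem stmt_13 (n D : ℕ) (hn : 0 < n) (hD : 0 < D)
    (C : Finset (Equiv.Perm (Fin n)))
    (hcov : ∀ π : Equiv.Perm (Fin n), ∃ σ ∈ C, kendallDist π σ ≤ D) :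
    (C.card : ℝ) ≥ (n.factorial : ℝ) * (n : ℝ) ^ n /
      (Real.exp (n : ℝ) * ((n : ℝ) + (D : ℝ)) ^ n) := by
  rw [ge_iff_le, div_le_iff₀ (by positivity)]
  have hfact : (n.factorial : ℝ) ≤ C.card * ((n + D).choose n : ℝ) := by
    exact_mod_cast factorial_le_card_mul_choose_of_covering hcov
  calc (n.factorial : ℝ) * (n : ℝ) ^ n
      ≤ C.card * ((n + D).choose n : ℝ) * (n : ℝ) ^ n := by gcongr
    _ = C.card * (((n + D).choose n : ℝ) * (n : ℝ) ^ n) := mul_assoc _ _ _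
    _ ≤ C.card * (Real.exp n * ((n : ℝ) + D) ^ n) := by
        exact mul_le_mul_of_nonneg_left (choose_mul_pow_le_exp_mul_pow n D) (Nat.cast_nonneg _)
end

section
/- Let c > 0 be a real constant and let n : ℕ → ℕ be a function such that the sequence n(k) − k/c is bounded (i.e., there is a constant K with |n(k) − k/c| ≤ K for all k). Then, as k → ∞, the ratio B_K^{(n(k))}(k) / C(n(k)+k−1, k) converges to the limit L = ∏_{i=2}^{∞} (1 − (c/(1+c))^i), and L is a strictly positive real number. Here C(·,·) denotes the binomial coefficient. -/
open Finset

/-- The inversions of `σ`: pairs of positions `a < b` with `σ b < σ a`. -/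
def inversions {n : ℕ} (σ : Equiv.Perm (Fin n)) : Finset (Fin n × Fin n) :=
  {p | p.1 < p.2 ∧ σ p.2 < σ p.1}

theorem mem_inversions {n : ℕ} {σ : Equiv.Perm (Fin n)} {a b : Fin n} :
    (a, b) ∈ inversions σ ↔ a < b ∧ σ b < σ a := by
  simp [inversions]

theorem card_inversions_mul_swap_erase_le {n : ℕ} (σ : Equiv.Perm (Fin n)) {i : ℕ}
    (h : i + 1 < n) :
    #((inversions (σ * Equiv.swap ⟨i, Nat.lt_of_succ_lt h⟩ ⟨i + 1, h⟩)).erase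
        (⟨i, Nat.lt_of_succ_lt h⟩, ⟨i + 1, h⟩)) ≤
      #((inversions σ).erase (⟨i, Nat.lt_of_succ_lt h⟩, ⟨i + 1, h⟩)) := by
  set t := Equiv.swap (⟨i, Nat.lt_of_succ_lt h⟩ : Fin n) ⟨i + 1, h⟩ with ht
  refine card_le_card_of_injOn (Prod.map t t) ?_ (t.injective.prodMap t.injective).injOn
  rintro ⟨a, b⟩ hab
  simp only [mem_coe, mem_erase, mem_inversions, ne_eq, Prod.mk.injEq, Equiv.Perm.mul_apply,
    Prod.map_apply] at hab ⊢
  have hne := hab.1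
  have hlt := hab.2.1
  refine ⟨?_, ?_, hab.2.2⟩
  · simp only [ht, Equiv.swap_apply_def]
    grind
  · simp only [ht, Equiv.swap_apply_def]
    grind

theorem card_inversions_mul_swap_le {n : ℕ} (σ : Equiv.Perm (Fin n)) {i : ℕ} (h : i + 1 < n) :
    #(inversions (σ * Equiv.swap ⟨i, Nat.lt_of_succ_lt h⟩ ⟨i + 1, h⟩)) ≤
      #(inversions σ) + 1 := by
  have h₁ := card_inversions_mul_swap_erase_le σ h
  have h₂ := card_le_card (erase_subset
    ((⟨i, Nat.lt_of_succ_lt h⟩, ⟨i + 1, h⟩) : Fin n × Fin n) (inversions σ))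
  have h₃ := pred_card_le_card_erase (a := ((⟨i, Nat.lt_of_succ_lt h⟩, ⟨i + 1, h⟩) : Fin n × Fin n))
    (s := inversions (σ * Equiv.swap ⟨i, Nat.lt_of_succ_lt h⟩ ⟨i + 1, h⟩))
  omega

theorem card_inversions_mul_swap_lt {n : ℕ} (σ : Equiv.Perm (Fin n)) {i : ℕ} (h : i + 1 < n)
    (hσ : σ ⟨i + 1, h⟩ < σ ⟨i, Nat.lt_of_succ_lt h⟩) :
    #(inversions (σ * Equiv.swap ⟨i, Nat.lt_of_succ_lt h⟩ ⟨i + 1, h⟩)) < #(inversions σ) := by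
  have h₁ := card_inversions_mul_swap_erase_le σ h
  rw [erase_eq_of_notMem (by simp [mem_inversions, hσ.le])] at h₁
  exact h₁.trans_lt (card_erase_lt_of_mem (by simp [mem_inversions, hσ]))

theorem inversions_one (n : ℕ) : inversions (1 : Equiv.Perm (Fin n)) = ∅ := by
  ext ⟨a, b⟩
  simpa [mem_inversions] using fun h : a < b => h.le

theorem exists_descent_of_ne_one {n : ℕ} {σ : Equiv.Perm (Fin n)} (hσ : σ ≠ 1) :
    ∃ (i : ℕ) (h : i + 1 < n), σ ⟨i + 1, h⟩ < σ ⟨i, Nat.lt_of_succ_lt h⟩ := by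
  contrapose! hσ
  cases n with
  | zero => exact Subsingleton.elim _ _
  | succ n =>
    have hmono : StrictMono σ := Fin.strictMono_iff_lt_succ.2 fun i =>
      lt_of_le_of_ne (hσ i (by omega)) (σ.injective.ne (by simp [Fin.ext_iff]))
    have := Subsingleton.elim (hmono.orderIsoOfSurjective σ σ.surjective) (OrderIso.refl _)
    ext a
    exact congrArg Fin.val (DFunLike.congr_fun this a)

theorem exists_adjacentTranspositions_prod {n : ℕ} (σ : Equiv.Perm (Fin n)) :
    ∃ l : List (Equiv.Perm (Fin n)), l.length ≤ #(inversions σ) ∧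
      (∀ t ∈ l, t ∈ adjacentTranspositions n) ∧ 1 = σ * l.prod := by
  induction hm : #(inversions σ) using Nat.strong_induction_on generalizing σ with
  | _ m ih =>
    by_cases hσ : σ = 1
    · exact ⟨[], by simp [hσ]⟩
    · obtain ⟨i, h, hi⟩ := exists_descent_of_ne_one hσ
      have hlt := card_inversions_mul_swap_lt σ h hi
      obtain ⟨l, hl, hadj, hprod⟩ := ih _ (hm ▸ hlt) _ rfl
      refine ⟨Equiv.swap ⟨i, Nat.lt_of_succ_lt h⟩ ⟨i + 1, h⟩ :: l, ?_, ?_, ?_⟩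
      · simp only [List.length_cons]
        omega
      · simpa using ⟨⟨i, h, rfl⟩, hadj⟩
      · rw [List.prod_cons, ← mul_assoc, ← hprod]

theorem card_inversions_le_length {n : ℕ} (l : List (Equiv.Perm (Fin n)))
    (hl : ∀ t ∈ l, t ∈ adjacentTranspositions n) (σ : Equiv.Perm (Fin n))
    (hσ : 1 = σ * l.prod) : #(inversions σ) ≤ l.length := by
  induction l generalizing σ with
  | nil =>
    obtain rfl : σ = 1 := by simpa using hσ.symm
    simp [inversions_one]
  | cons t l ih =>
    obtain ⟨i, h, ht⟩ := hl t (by simp)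
    have h₁ := ih (fun s hs => hl s (by simp [hs])) (σ * t) (by simpa [mul_assoc] using hσ)
    have h₂ := card_inversions_mul_swap_le (σ * t) h
    rw [← ht, mul_assoc, show t * t = 1 by simp [ht], mul_one] at h₂
    simp only [List.length_cons]
    omega

theorem kendallDist_one_right {n : ℕ} (σ : Equiv.Perm (Fin n)) :
    kendallDist σ 1 = #(inversions σ) := by
  obtain ⟨l, hl, hadj, hprod⟩ := exists_adjacentTranspositions_prod σ
  unfold kendallDist
  refine le_antisymm (le_trans (Nat.sInf_le ⟨l, rfl, hadj, hprod⟩) hl) ?_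
  refine le_csInf ⟨_, l, rfl, hadj, hprod⟩ ?_
  rintro k ⟨l', rfl, hadj', hprod'⟩
  exact card_inversions_le_length l' hadj' σ hprod'

/-- The permutation with `0 ↦ p` whose values at the successors are ordered as those of `τ`. -/
def insertFirst {n : ℕ} (p : Fin (n + 1)) (τ : Equiv.Perm (Fin n)) : Equiv.Perm (Fin (n + 1)) :=
  p.cycleRange.symm * Equiv.Perm.decomposeFin.symm (0, τ)

theorem insertFirst_zero {n : ℕ} (p : Fin (n + 1)) (τ : Equiv.Perm (Fin n)) :
    insertFirst p τ 0 = p := by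
  simp [insertFirst]

theorem insertFirst_succ {n : ℕ} (p : Fin (n + 1)) (τ : Equiv.Perm (Fin n)) (j : Fin n) :
    insertFirst p τ j.succ = p.succAbove (τ j) := by
  simp [insertFirst]

theorem insertFirst_bijective (n : ℕ) :
    Function.Bijective fun q : Fin (n + 1) × Equiv.Perm (Fin n) => insertFirst q.1 q.2 := by
  rw [Fintype.bijective_iff_injective_and_card]
  constructor
  · rintro ⟨p, τ⟩ ⟨p', τ'⟩ h
    have hp : p = p' := by
      simpa [insertFirst_zero] using DFunLike.congr_fun h 0
    subst hp
    refine Prod.ext rfl (Equiv.ext fun j => ?_)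
    simpa [insertFirst_succ] using DFunLike.congr_fun h j.succ
  · simp [Fintype.card_perm, Nat.factorial_succ]

theorem card_inversions_insertFirst {n : ℕ} (p : Fin (n + 1)) (τ : Equiv.Perm (Fin n)) :
    #(inversions (insertFirst p τ)) = p + #(inversions τ) := by
  have hp : (p : ℕ) = ∑ j : Fin n, if p.succAbove (τ j) < p then 1 else 0 := by
    rw [Equiv.sum_comp τ fun j => if p.succAbove j < p then 1 else 0, ← card_filter]
    have : (univ.filter fun j : Fin n => p.succAbove j < p) =
        univ.filter fun j : Fin n => (j : ℕ) < p := by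
      ext j
      rw [mem_filter_univ, mem_filter_univ, Fin.succAbove_lt_iff_castSucc_lt, Fin.lt_def,
        Fin.val_castSucc]
    rw [this, Fin.card_filter_val_lt, min_eq_right (by omega)]
  conv_rhs => rw [hp]
  simp only [inversions, card_filter, Fintype.sum_prod_type, Fin.sum_univ_succ, insertFirst_zero,
    insertFirst_succ]
  simp [(Fin.strictMono_succAbove p).lt_iff_lt]

open PowerSeries in
/-- The generating function of the inversion number over `S_n`. -/
theorem sum_X_pow_card_inversions (n : ℕ) :
    ∑ σ : Equiv.Perm (Fin n), (X : ℝ⟦X⟧) ^ #(inversions σ) =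
      ∏ j ∈ range n, ∑ i ∈ range (j + 1), X ^ i := by
  induction n with
  | zero => simp [inversions]
  | succ n ih =>
    rw [← (insertFirst_bijective n).sum_comp, Fintype.sum_prod_type, prod_range_succ, ← ih,
      mul_comm, sum_range, sum_mul]
    simp only [card_inversions_insertFirst, pow_add, mul_sum]

open PowerSeries in
theorem mk_kendallBall (n : ℕ) :
    (mk fun r => (kendallBall n r : ℝ)) =
      (∑ σ : Equiv.Perm (Fin n), (X : ℝ⟦X⟧) ^ #(inversions σ)) * PowerSeries.mk 1 := by
  ext r
  simp [kendallBall, kendallDist_one_right, sum_mul, coeff_X_pow_mul']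

open PowerSeries in
theorem mk_kendallBall_succ (m : ℕ) :
    (mk fun r => (kendallBall (m + 1) r : ℝ)) =
      (∏ j ∈ range m, (1 - (X : ℝ⟦X⟧) ^ (j + 2))) * mk fun r => ((m + r).choose m : ℝ) := by
  have hgeom (j : ℕ) : ∑ i ∈ range (j + 1), (X : ℝ⟦X⟧) ^ i = (1 - X ^ (j + 1)) * PowerSeries.mk 1 := by
    rw [← geom_sum_mul_neg, mul_assoc, mul_comm (1 - X), mk_one_mul_one_sub_eq_one, mul_one]
  rw [mk_kendallBall, sum_X_pow_card_inversions, prod_range_succ', ← mk_one_pow_eq_mk_choose_add]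
  simp only [zero_add, range_one, sum_singleton, pow_zero, mul_one, hgeom, prod_mul_distrib,
    prod_const, card_range]
  rw [pow_succ, mul_assoc]

/-- The coefficient of `X ^ k` in `X ^ i / (1 - X) ^ (m + 1)`. -/
def shiftedChoose (m k i : ℕ) : ℝ := if i ≤ k then ((m + (k - i)).choose m : ℝ) else 0

open PowerSeries in
theorem kendallBall_succ_eq_sum (m k : ℕ) :
    (kendallBall (m + 1) k : ℝ) =
      ∑ s ∈ (range m).powerset, (-1) ^ #s * shiftedChoose m k (∑ j ∈ s, (j + 2)) := by
  have h := congrArg (coeff k) (mk_kendallBall_succ m)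
  simp only [sub_eq_add_neg, prod_one_add, sum_mul, map_sum, coeff_mk] at h
  rw [h]
  refine sum_congr rfl fun s _ => ?_
  rw [prod_neg, prod_pow_eq_pow_sum, mul_assoc]
  rw [show ((-1 : ℝ⟦X⟧) ^ #s) = C ((-1) ^ #s) by simp, coeff_C_mul, coeff_X_pow_mul', coeff_mk,
    shiftedChoose]

theorem shiftedChoose_zero (m k : ℕ) : shiftedChoose m k 0 = ((m + k).choose m : ℝ) := by
  simp [shiftedChoose]

theorem shiftedChoose_nonneg (m k i : ℕ) : 0 ≤ shiftedChoose m k i := by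
  unfold shiftedChoose
  split_ifs <;> positivity

theorem shiftedChoose_succ {m : ℕ} (hm : 0 < m) (k i : ℕ) :
    shiftedChoose m k (i + 1) = shiftedChoose m k i * (((k : ℝ) - i) / (m + k - i)) := by
  rcases lt_trichotomy i k with h | rfl | h
  · obtain ⟨d, rfl⟩ := Nat.exists_eq_add_of_lt h
    have h₁ : i + d + 1 - (i + 1) = d := by omega
    have h₂ : i + d + 1 - i = d + 1 := by omega
    have h₃ : ((m + d).choose m : ℝ) * (m + d + 1) = ((m + (d + 1)).choose m : ℝ) * (d + 1) := by
      have := Nat.choose_mul_succ_eq (m + d) m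
      rw [show m + d + 1 - m = d + 1 by omega] at this
      exact_mod_cast this
    have h₄ : (m : ℝ) + d + 1 ≠ 0 := by positivity
    rw [shiftedChoose, shiftedChoose, if_pos (by omega), if_pos (by omega), h₁, h₂]
    push_cast
    rw [show (m : ℝ) + (i + d + 1) - i = m + d + 1 by ring,
      show (i : ℝ) + d + 1 - i = d + 1 by ring, ← mul_div_assoc, eq_div_iff h₄, h₃]
  · simp [shiftedChoose]
  · rw [shiftedChoose, shiftedChoose, if_neg (by omega), if_neg (by omega), zero_mul]

theorem shiftedChoose_le {m k : ℕ} (hm : 0 < m) {ρ : ℝ} (hρ : (k : ℝ) / (m + k) ≤ ρ) (i : ℕ) :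
    shiftedChoose m k i ≤ ρ ^ i * (m + k).choose m := by
  have hρ₀ : 0 ≤ ρ := le_trans (by positivity) hρ
  induction i with
  | zero => simp [shiftedChoose_zero]
  | succ i ih =>
    rcases lt_or_ge i k with h | h
    · have hm' : (0 : ℝ) < m := by exact_mod_cast hm
      have hik : (i : ℝ) < k := by exact_mod_cast h
      have hi : (0 : ℝ) ≤ i := by positivity
      have hq : ((k : ℝ) - i) / (m + k - i) ≤ ρ := by
        refine le_trans ?_ hρ
        rw [div_le_div_iff₀ (by linarith) (by positivity)]
        nlinarith
      rw [shiftedChoose_succ hm, pow_succ]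
      calc _ ≤ shiftedChoose m k i * ρ := by
            gcongr
            exact shiftedChoose_nonneg m k i
        _ ≤ ρ ^ i * (m + k).choose m * ρ := by gcongr
        _ = _ := by ring
    · rw [shiftedChoose, if_neg (by omega)]
      positivity

open Filter Topology

theorem tendsto_sub_div_add_sub {c : ℝ} (hc : 0 < c) {m : ℕ → ℕ}
    (hm : Tendsto (fun k => (m k : ℝ) / k) atTop (𝓝 (1 / c))) (i : ℕ) :
    Tendsto (fun k : ℕ => ((k : ℝ) - i) / (m k + k - i)) atTop (𝓝 (c / (1 + c))) := by
  have hi : Tendsto (fun k : ℕ => (i : ℝ) / k) atTop (𝓝 0) :=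
    tendsto_const_div_atTop_nhds_zero_nat _
  have hlim := (tendsto_const_nhds (x := (1 : ℝ))).sub hi |>.div
    ((hm.add (tendsto_const_nhds (x := (1 : ℝ)))).sub hi) (by rw [sub_zero]; positivity)
  have hval : (1 - 0) / (1 / c + 1 - 0) = c / (1 + c) := by
    rw [sub_zero, sub_zero, div_add_one hc.ne', one_div_div]
  rw [hval] at hlim
  refine hlim.congr' ?_
  filter_upwards [eventually_gt_atTop 0] with k hk
  have hk' : (k : ℝ) ≠ 0 := by positivity
  simp only [Pi.div_apply]
  rw [← mul_div_mul_right _ _ hk']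
  congr 1 <;> field_simp

theorem tendsto_shiftedChoose_div {c : ℝ} (hc : 0 < c) {m : ℕ → ℕ}
    (hm : Tendsto (fun k => (m k : ℝ) / k) atTop (𝓝 (1 / c)))
    (hpos : ∀ᶠ k in atTop, 0 < m k) (i : ℕ) :
    Tendsto (fun k : ℕ => shiftedChoose (m k) k i / (m k + k).choose (m k)) atTop
      (𝓝 ((c / (1 + c)) ^ i)) := by
  induction i with
  | zero =>
    refine tendsto_const_nhds.congr fun k => ?_
    have : ((m k + k).choose (m k) : ℝ) ≠ 0 := by
      exact_mod_cast (Nat.choose_pos (Nat.le_add_right _ _)).ne'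
    rw [shiftedChoose_zero, div_self this, pow_zero]
  | succ i ih =>
    rw [pow_succ]
    refine (ih.mul (tendsto_sub_div_add_sub hc hm i)).congr' ?_
    filter_upwards [hpos] with k hk
    rw [shiftedChoose_succ hk, div_mul_eq_mul_div]

theorem summable_pow_add_two {x : ℝ} (hx₀ : 0 ≤ x) (hx₁ : x < 1) :
    Summable fun i : ℕ => x ^ (i + 2) :=
  (summable_nat_add_iff 2).2 (summable_geometric_of_lt_one hx₀ hx₁)

theorem summable_norm_neg_pow_add_two {x : ℝ} (hx₀ : 0 ≤ x) (hx₁ : x < 1) :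
    Summable fun i : ℕ => ‖-x ^ (i + 2)‖ := by
  simpa [abs_of_nonneg hx₀] using summable_pow_add_two hx₀ hx₁

theorem tendsto_kendallBall_succ_div {c : ℝ} (hc : 0 < c) {m : ℕ → ℕ}
    (hm : Tendsto (fun k => (m k : ℝ) / k) atTop (𝓝 (1 / c))) :
    Tendsto (fun k : ℕ => (kendallBall (m k + 1) k : ℝ) / (m k + k).choose (m k)) atTop
      (𝓝 (∏' i : ℕ, (1 - (c / (1 + c)) ^ (i + 2)))) := by
  set x := c / (1 + c)
  have hx₀ : 0 ≤ x := by positivity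
  have hx₁ : x < 1 := (div_lt_one (by positivity)).2 (by linarith)
  obtain ⟨ρ, hxρ, hρ₁⟩ := exists_between hx₁
  have hρ₀ : 0 ≤ ρ := hx₀.trans hxρ.le
  have hmtop : Tendsto m atTop atTop := by
    rw [← tendsto_natCast_atTop_iff (R := ℝ)]
    refine (hm.pos_mul_atTop (by positivity) tendsto_natCast_atTop_atTop).congr' ?_
    filter_upwards [eventually_gt_atTop 0] with k hk
    exact div_mul_cancel₀ _ (by positivity)
  have hpos : ∀ᶠ k in atTop, 0 < m k := hmtop.eventually_gt_atTop 0
  have hρ : ∀ᶠ k : ℕ in atTop, (k : ℝ) / (m k + k) ≤ ρ := by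
    have := (tendsto_sub_div_add_sub hc hm 0).eventually_le_const hxρ
    simpa using this
  simp only [sub_eq_add_neg]
  rw [tprod_one_add (summable_finsetProd_of_summable_norm (summable_norm_neg_pow_add_two hx₀ hx₁))]
  have hmain := tendsto_tsum_of_dominated_convergence (𝓕 := atTop)
    (f := fun k (s : Finset ℕ) => if s ⊆ range (m k) then
      (-1) ^ #s * (shiftedChoose (m k) k (∑ j ∈ s, (j + 2)) / (m k + k).choose (m k)) else 0)
    (g := fun s => ∏ j ∈ s, -x ^ (j + 2)) (bound := fun s => ∏ j ∈ s, ρ ^ (j + 2))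
    (summable_finsetProd_of_summable_nonneg (fun _ => by positivity)
      (summable_pow_add_two hρ₀ hρ₁)) ?_ ?_
  · refine hmain.congr fun k => ?_
    rw [tsum_eq_sum (s := (range (m k)).powerset) (by simp +contextual), kendallBall_succ_eq_sum,
      sum_div]
    refine sum_congr rfl fun s hs => ?_
    rw [if_pos (mem_powerset.1 hs), mul_div_assoc]
  · intro s
    rw [prod_neg, prod_pow_eq_pow_sum]
    refine ((tendsto_shiftedChoose_div hc hm hpos _).const_mul ((-1) ^ #s)).congr' ?_
    filter_upwards [hmtop.eventually_gt_atTop (s.sup id)] with k hk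
    have hs : s ⊆ range (m k) := fun j hj => mem_range.2 ((le_sup (f := id) hj).trans_lt hk)
    rw [if_pos hs]
  · filter_upwards [hpos, hρ] with k hk hk'
    intro s
    rw [prod_pow_eq_pow_sum]
    split_ifs
    · rw [norm_mul, norm_pow, norm_neg, norm_one, one_pow, one_mul,
        Real.norm_of_nonneg (div_nonneg (shiftedChoose_nonneg _ _ _) (by positivity))]
      exact div_le_of_le_mul₀ (by positivity) (by positivity) (shiftedChoose_le hk hk' _)
    · rw [norm_zero]
      positivity

theorem tendsto_div_of_abs_sub_le {a : ℝ} {u : ℕ → ℝ} {K : ℝ}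
    (h : ∀ k : ℕ, |u k - k * a| ≤ K) : Tendsto (fun k : ℕ => u k / k) atTop (𝓝 a) := by
  rw [tendsto_iff_norm_sub_tendsto_zero]
  refine squeeze_zero' (.of_forall fun _ => norm_nonneg _) ?_
    (tendsto_const_div_atTop_nhds_zero_nat K)
  filter_upwards [eventually_gt_atTop 0] with k hk
  have hk' : (0 : ℝ) < k := by exact_mod_cast hk
  rw [show u k / k - a = (u k - k * a) / k by field_simp, norm_div, Real.norm_natCast]
  gcongr
  exact h k

/-- If `n(k) = k/c + O(1)`, then `B_K(k)/C(n(k)+k-1, k)` converges to the strictly positive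
limit `∏_{i=2}^∞ (1 - (c/(1+c))^i)`. -/
theorem stmt_14 (c : ℝ) (hc : 0 < c) (n : ℕ → ℕ) (K : ℝ)
    (hbound : ∀ k : ℕ, |(n k : ℝ) - (k : ℝ) / c| ≤ K) :
    Multipliable (fun i : ℕ => 1 - (c / (1 + c)) ^ (i + 2)) ∧
    0 < ∏' i : ℕ, (1 - (c / (1 + c)) ^ (i + 2)) ∧
    Filter.Tendsto
      (fun k : ℕ => (kendallBall (n k) k : ℝ) / (((n k + k - 1).choose k : ℕ) : ℝ))
      Filter.atTop (nhds (∏' i : ℕ, (1 - (c / (1 + c)) ^ (i + 2)))) := by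
  have hx₀ : 0 ≤ c / (1 + c) := by positivity
  have hx₁ : c / (1 + c) < 1 := (div_lt_one (by positivity)).2 (by linarith)
  have hsum := summable_norm_neg_pow_add_two hx₀ hx₁
  have hfactor (i : ℕ) : 0 < 1 - (c / (1 + c)) ^ (i + 2) :=
    sub_pos.2 (pow_lt_one₀ hx₀ hx₁ (by omega))
  refine ⟨by simpa only [sub_eq_add_neg] using multipliable_one_add_of_summable hsum,
    lt_of_le_of_ne ?_ (Ne.symm ?_), ?_⟩
  · exact tprod_nonneg fun i => (hfactor i).le
  · simpa only [sub_eq_add_neg] using tprod_one_add_ne_zero_of_summable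
      (fun i => by simpa only [sub_eq_add_neg] using (hfactor i).ne') hsum
  have hn : Tendsto (fun k => (n k : ℝ) / k) atTop (𝓝 (1 / c)) :=
    tendsto_div_of_abs_sub_le fun k => by simpa [div_eq_mul_inv] using hbound k
  have hpos : ∀ᶠ k in atTop, 0 < n k := by
    filter_upwards [hn.eventually_const_lt (show 0 < 1 / c by positivity)] with k hk
    rcases (n k).eq_zero_or_pos with h | h
    · simp [h] at hk
    · exact h
  have hm : Tendsto (fun k => ((n k - 1 : ℕ) : ℝ) / k) atTop (𝓝 (1 / c)) := by
    have := hn.sub (tendsto_const_div_atTop_nhds_zero_nat 1)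
    rw [sub_zero] at this
    refine this.congr' ?_
    filter_upwards [hpos] with k hk
    rw [Nat.cast_sub hk, Nat.cast_one, sub_div]
  refine (tendsto_kendallBall_succ_div hc hm).congr' ?_
  filter_upwards [hpos] with k hk
  rw [Nat.sub_add_cancel hk, show n k + k - 1 = n k - 1 + k by omega, Nat.choose_symm_add]
end
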